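/- If a group G with finite inverse-closed generating set X has the falsification by fellow traveler property, then the full language of geodesic words over X^{±1} (the set of all words over X^{±1} that are geodesic in Γ(G,X)) is a regular language. -/

import Mathlib

/-!  Common framework: words over an inverse-closed generating set, word length,
geodesics, falsification by fellow traveler property, almost convexity. -/

namespace ACPaper

variable {β G : Type*} [Group G]

/-- A letter is a generator (`Sum.inl`) or the formal inverse of a generator (`Sum.inr`);
this realizes the inverse-closed alphabet `X^{±1}`. -/
def letterEval (gen : β → G) : β ⊕ β → G :=
  Sum.elim gen fun b => (gen b)⁻¹

/-- Evaluation of a word over `X^{±1}` in the group. -/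
def eval (gen : β → G) (w : List (β ⊕ β)) : G :=
  (w.map (letterEval gen)).prod

/-- `gen` is a generating set: every element is represented by some word. -/
def Generates (gen : β → G) : Prop :=
  ∀ g : G, ∃ w : List (β ⊕ β), eval gen w = g

/-- Word length of a group element with respect to the generating set. -/
noncomputable def wlen (gen : β → G) (g : G) : ℕ :=
  sInf {n : ℕ | ∃ w : List (β ⊕ β), eval gen w = g ∧ w.length = n}

/-- A word is geodesic if its length equals the word length of the element it represents. -/
def IsGeodesic (gen : β → G) (w : List (β ⊕ β)) : Prop :=
  w.length = wlen gen (eval gen w)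

/-- The point reached after `t` steps along the unit-speed path labelled by `w`
(the path remains at its endpoint after time `w.length`). -/
def pos (gen : β → G) (w : List (β ⊕ β)) (t : ℕ) : G :=
  eval gen (w.take t)

/-- Synchronous falsification by fellow traveler property with constant `k`:
every non-geodesic word is synchronously `k`-fellow traveled by a shorter word
representing the same element. -/
def SynchFFTP (gen : β → G) (k : ℕ) : Prop :=
  ∀ w : List (β ⊕ β), ¬ IsGeodesic gen w →
    ∃ w' : List (β ⊕ β), eval gen w' = eval gen w ∧ w'.length < w.length ∧
      ∀ t : ℕ, wlen gen ((pos gen w t)⁻¹ * pos gen w' t) ≤ k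

/-- The path starting at `g` labelled by the word `w` stays in the ball of radius `N`
about the identity. -/
def PathInBall (gen : β → G) (N : ℕ) (g : G) (w : List (β ⊕ β)) : Prop :=
  ∀ t : ℕ, wlen gen (g * pos gen w t) ≤ N

/-- Almost convexity with constant `C`: any two elements of the sphere of radius `N ≥ 1`
at distance at most `2` are joined by a path of length at most `C` inside the ball of
radius `N`. -/
def AlmostConvexWith (gen : β → G) (C : ℕ) : Prop :=
  ∀ N : ℕ, 1 ≤ N → ∀ g g' : G, wlen gen g = N → wlen gen g' = N →
    wlen gen (g⁻¹ * g') ≤ 2 →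
    ∃ w : List (β ⊕ β), g * eval gen w = g' ∧ w.length ≤ C ∧ PathInBall gen N g w

/-- Almost convexity: almost convex with some positive constant. -/
def AlmostConvex (gen : β → G) : Prop :=
  ∃ C : ℕ, 0 < C ∧ AlmostConvexWith gen C

section

variable {gen : β → G}

theorem eval_append (u v : List (β ⊕ β)) : eval gen (u ++ v) = eval gen u * eval gen v := by
  simp [eval]

theorem wlen_eval_le (w : List (β ⊕ β)) : wlen gen (eval gen w) ≤ w.length :=
  Nat.sInf_le ⟨w, rfl, rfl⟩

theorem Generates.exists_length_eq_wlen (hgen : Generates gen) (g : G) :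
    ∃ w : List (β ⊕ β), eval gen w = g ∧ w.length = wlen gen g := by
  obtain ⟨w, hw⟩ := hgen g
  exact Nat.sInf_mem (s := {n : ℕ | ∃ w : List (β ⊕ β), eval gen w = g ∧ w.length = n})
    ⟨_, w, hw, rfl⟩

theorem Generates.wlen_mul_le (hgen : Generates gen) (g h : G) :
    wlen gen (g * h) ≤ wlen gen g + wlen gen h := by
  obtain ⟨u, rfl, hu⟩ := hgen.exists_length_eq_wlen g
  obtain ⟨v, rfl, hv⟩ := hgen.exists_length_eq_wlen h
  rw [← hu, ← hv, ← eval_append, ← List.length_append]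
  exact wlen_eval_le _

theorem eval_map_swap_reverse (w : List (β ⊕ β)) :
    eval gen (w.map Sum.swap).reverse = (eval gen w)⁻¹ := by
  induction w with
  | nil => simp [eval]
  | cons a w ih =>
    rw [List.map_cons, List.reverse_cons, eval_append, ih]
    cases a <;> simp [eval, letterEval]

theorem Generates.wlen_inv_le (hgen : Generates gen) (g : G) :
    wlen gen g⁻¹ ≤ wlen gen g := by
  obtain ⟨u, rfl, hu⟩ := hgen.exists_length_eq_wlen g
  rw [← hu, ← eval_map_swap_reverse]
  simpa using wlen_eval_le (gen := gen) (u.map Sum.swap).reverse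

theorem Generates.wlen_le_wlen_mul_add (hgen : Generates gen) (g h : G) :
    wlen gen g ≤ wlen gen (g * h) + wlen gen h := by
  have h₁ := hgen.wlen_mul_le (g * h) h⁻¹
  have h₂ := hgen.wlen_inv_le h
  rw [mul_inv_cancel_right] at h₁
  lia

theorem Generates.finite_ball [Finite β] (hgen : Generates gen) (k : ℕ) :
    Finite {g : G // wlen gen g ≤ k} := by
  refine Set.Finite.subset ((List.finite_length_le (β ⊕ β) k).image (eval gen)) fun g hg => ?_
  obtain ⟨w, hw, hlen⟩ := hgen.exists_length_eq_wlen g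
  exact ⟨w, hlen.trans_le hg, hw⟩

theorem Generates.isGeodesic_of_append (hgen : Generates gen) {w u : List (β ⊕ β)}
    (h : IsGeodesic gen (w ++ u)) : IsGeodesic gen w := by
  have h₁ := hgen.wlen_mul_le (eval gen w) (eval gen u)
  have h₂ := wlen_eval_le (gen := gen) w
  have h₃ := wlen_eval_le (gen := gen) u
  rw [IsGeodesic, eval_append, List.length_append] at h
  rw [IsGeodesic]
  lia

/-- The `k`-level of `w`: the change in word length on moving from the endpoint of `w` by an
element of the ball of radius `k`. -/
noncomputable def level (hgen : Generates gen) (k : ℕ) (w : List (β ⊕ β))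
    (g : {g : G // wlen gen g ≤ k}) : Set.Icc (-k : ℤ) k :=
  ⟨wlen gen (eval gen w * g) - wlen gen (eval gen w), by
    have h₁ := hgen.wlen_mul_le (eval gen w) g
    have h₂ := hgen.wlen_le_wlen_mul_add (eval gen w) g
    have h₃ := g.2
    rw [Set.mem_Icc]
    lia⟩

theorem SynchFFTP.isGeodesic_append_of_level_eq {k : ℕ} (hk : SynchFFTP gen k)
    (hgen : Generates gen) {v w : List (β ⊕ β)} (hv : IsGeodesic gen v) (hw : IsGeodesic gen w)
    (hvw : level hgen k v = level hgen k w) {u : List (β ⊕ β)}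
    (hwu : IsGeodesic gen (w ++ u)) : IsGeodesic gen (v ++ u) := by
  by_contra hvu
  obtain ⟨v', heval, hlen, hfellow⟩ := hk _ hvu
  have hg := hfellow v.length
  simp only [pos, List.take_left] at hg
  set p := v'.take v.length
  set q := v'.drop v.length
  set g := (eval gen v)⁻¹ * eval gen p with hgdef
  have hpq : v' = p ++ q := (List.take_append_drop _ _).symm
  have hvg : eval gen v * g = eval gen p := by rw [hgdef, mul_inv_cancel_left]
  have hgq : g * eval gen q = eval gen u := by
    rw [hpq, eval_append, eval_append] at heval
    rw [hgdef, mul_assoc, heval, inv_mul_cancel_left]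
  have hlevel : (wlen gen (eval gen v * g) : ℤ) - wlen gen (eval gen v) =
      wlen gen (eval gen w * g) - wlen gen (eval gen w) :=
    congrArg Subtype.val (congrFun hvw ⟨g, hg⟩)
  have hp := wlen_eval_le (gen := gen) p
  have hq := wlen_eval_le (gen := gen) q
  have hwgq := hgen.wlen_mul_le (eval gen w * g) (eval gen q)
  rw [mul_assoc, hgq] at hwgq
  rw [hvg] at hlevel
  rw [hpq, List.length_append, List.length_append] at hlen
  rw [IsGeodesic] at hv hw
  rw [IsGeodesic, eval_append, List.length_append] at hwu
  lia

end

/-- If `(G,X)` has the falsification by fellow traveler property, then the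
full language of geodesic words over `X^{±1}` is a regular language. -/
theorem fftp_implies_geodesics_regular {β G : Type*} [Group G] [Fintype β]
    (gen : β → G) (hgen : Generates gen)
    (h : ∃ k : ℕ, 0 < k ∧ SynchFFTP gen k) :
    Language.IsRegular {w : List (β ⊕ β) | IsGeodesic gen w} := by
  obtain ⟨k, -, hk⟩ := h
  have := hgen.finite_ball k
  refine Language.IsRegular.of_finite_range_leftQuotient ?_
  let key (w : List (β ⊕ β)) := (IsGeodesic gen w, level hgen k w)
  refine Set.Finite.subset ((Set.toFinite (Set.range key)).image fun c =>
    Language.leftQuotient {w : List (β ⊕ β) | IsGeodesic gen w} (Function.invFun key c)) ?_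
  rintro _ ⟨w, rfl⟩
  refine ⟨key w, ⟨w, rfl⟩, ?_⟩
  obtain ⟨hgeo, hlevel⟩ := Prod.ext_iff.mp (Function.invFun_eq (f := key) ⟨w, rfl⟩)
  have hgeo : IsGeodesic gen (Function.invFun key (key w)) ↔ IsGeodesic gen w := iff_of_eq hgeo
  ext u
  constructor
  · intro hu
    have hv := hgen.isGeodesic_of_append hu
    exact hk.isGeodesic_append_of_level_eq hgen (hgeo.mp hv) hv hlevel.symm hu
  · intro hu
    have hw := hgen.isGeodesic_of_append hu
    exact hk.isGeodesic_append_of_level_eq hgen (hgeo.mpr hw) hw hlevel hu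

end ACPaper
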